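/- arXiv:2510.23943 — 4 statements merged into one kernel-verified Lean document; each statement's English description precedes it below -/
import Mathlib

section
/- Let d ≥ 1 and let f = L ∘ S^d ∘ ⋯ ∘ S^0 be a sinusoidal INR of depth d with weight matrices W^0, …, W^d, biases b^0, …, b^d, and output matrix L. Fix k with 1 ≤ k ≤ d and let f̃ be the network obtained from f by replacing the k-th layer's parameters W^k, b^k by W̃^k ∈ ℝ^{n_{k+1}×n_k} and b̃^k ∈ ℝ^{n_{k+1}} (all other layers unchanged). Then for every x ∈ ℝ^{n_0}, ‖f(x) − f̃(x)‖∞ ≤ (‖W^k − W̃^k‖∞ + ‖b^k − b̃^k‖∞) · ‖L‖∞ · ∏_{i=k+1}^{d} ‖W^i‖∞; in particular the supremum over x of ‖f(x) − f̃(x)‖∞ is bounded by this quantity. -/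
open Real

/-- A sinusoidal layer output: `sin (W x + b)` componentwise, written pointwise. -/
noncomputable def sinLayer {m n : ℕ} (W : Matrix (Fin m) (Fin n) ℝ) (b : Fin m → ℝ)
    (x : Fin n → ℝ) : Fin m → ℝ :=
  fun i => Real.sin (W.mulVec x i + b i)

/-- The composition `S^{k-1} ∘ ⋯ ∘ S^0` of the first `k` sinusoidal layers. -/
noncomputable def forward (dims : ℕ → ℕ)
    (W : ∀ i, Matrix (Fin (dims (i + 1))) (Fin (dims i)) ℝ)
    (b : ∀ i, Fin (dims (i + 1)) → ℝ) :
    (k : ℕ) → (Fin (dims 0) → ℝ) → (Fin (dims k) → ℝ)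
  | 0 => fun x => x
  | k + 1 => fun x => sinLayer (W k) (b k) (forward dims W b k x)

/-- The `∞`-operator norm of a real matrix: the maximum absolute row sum. -/
noncomputable def matNorm {m n : ℕ} (W : Matrix (Fin m) (Fin n) ℝ) : ℝ :=
  ⨆ i, ∑ j, |W i j|

theorem matNorm_nonneg' {m n : ℕ} (W : Matrix (Fin m) (Fin n) ℝ) : 0 ≤ matNorm W :=
  Real.iSup_nonneg fun i => Finset.sum_nonneg fun j _ => abs_nonneg _

theorem mulVec_bound {m n : ℕ} (W : Matrix (Fin m) (Fin n) ℝ) (x : Fin n → ℝ) :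
    ‖W.mulVec x‖ ≤ matNorm W * ‖x‖ := by
  rw [pi_norm_le_iff_of_nonneg (mul_nonneg (matNorm_nonneg' W) (norm_nonneg x))]
  intro i
  have h1 : ∑ j, |W i j| ≤ matNorm W :=
    le_ciSup (f := fun i => ∑ j, |W i j|) (Set.finite_range _).bddAbove i
  calc ‖W.mulVec x i‖ = |∑ j, W i j * x j| := rfl
    _ ≤ ∑ j, |W i j * x j| := Finset.abs_sum_le_sum_abs _ _
    _ ≤ ∑ j, |W i j| * ‖x‖ := by
        refine Finset.sum_le_sum fun j _ => ?_
        rw [abs_mul]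
        exact mul_le_mul_of_nonneg_left (norm_le_pi_norm x j) (abs_nonneg _)
    _ = (∑ j, |W i j|) * ‖x‖ := by rw [Finset.sum_mul]
    _ ≤ _ := mul_le_mul_of_nonneg_right h1 (norm_nonneg x)

theorem sin_sub_bound (a c : ℝ) : |Real.sin a - Real.sin c| ≤ |a - c| := by
  rw [Real.sin_sub_sin, abs_mul, abs_mul]
  have h1 : |Real.sin ((a - c) / 2)| ≤ |(a - c) / 2| := Real.abs_sin_le_abs
  have h2 := Real.abs_cos_le_one ((a + c) / 2)
  rw [abs_div, abs_two] at h1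
  rw [abs_two]
  nlinarith [abs_nonneg (Real.sin ((a - c) / 2)), abs_nonneg (Real.cos ((a + c) / 2))]

theorem sinLayer_sub {m n : ℕ} (W W' : Matrix (Fin m) (Fin n) ℝ) (b b' : Fin m → ℝ)
    (x y : Fin n → ℝ) :
    ‖sinLayer W b x - sinLayer W' b' y‖ ≤ ‖(W.mulVec x + b) - (W'.mulVec y + b')‖ := by
  rw [pi_norm_le_iff_of_nonneg (norm_nonneg _)]
  intro i
  exact (sin_sub_bound _ _).trans (norm_le_pi_norm ((W.mulVec x + b) - (W'.mulVec y + b')) i)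

theorem sinLayer_norm {m n : ℕ} (W : Matrix (Fin m) (Fin n) ℝ) (b : Fin m → ℝ)
    (x : Fin n → ℝ) : ‖sinLayer W b x‖ ≤ 1 := by
  rw [pi_norm_le_iff_of_nonneg zero_le_one]
  intro i
  exact Real.abs_sin_le_one _

theorem pruning_stability
    (d : ℕ) (hd : 1 ≤ d) (dims : ℕ → ℕ) (nout : ℕ)
    (W W' : ∀ i, Matrix (Fin (dims (i + 1))) (Fin (dims i)) ℝ)
    (b b' : ∀ i, Fin (dims (i + 1)) → ℝ)
    (L : Matrix (Fin nout) (Fin (dims (d + 1))) ℝ)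
    (k : ℕ) (hk1 : 1 ≤ k) (hk2 : k ≤ d)
    (hW : ∀ i, i ≠ k → W' i = W i) (hb : ∀ i, i ≠ k → b' i = b i)
    (x : Fin (dims 0) → ℝ) :
    ‖L.mulVec (forward dims W b (d + 1) x) - L.mulVec (forward dims W' b' (d + 1) x)‖ ≤
      (matNorm (W k - W' k) + ‖b k - b' k‖) * matNorm L *
        ∏ i ∈ Finset.Icc (k + 1) d, matNorm (W i) := by
  have hlow : ∀ j, j ≤ k → forward dims W' b' j x = forward dims W b j x := by
    intro j
    induction j with
    | zero => intro _; rfl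
    | succ j ih =>
      intro hj
      simp only [forward]
      rw [ih (by omega), hW j (by omega), hb j (by omega)]
  have hone : ‖forward dims W b k x‖ ≤ 1 := by
    obtain ⟨j, rfl⟩ : ∃ j, k = j + 1 := ⟨k - 1, by omega⟩
    exact sinLayer_norm _ _ _
  have key : ∀ e, k ≤ e →
      ‖forward dims W b (e + 1) x - forward dims W' b' (e + 1) x‖ ≤
        (matNorm (W k - W' k) + ‖b k - b' k‖) *
          ∏ i ∈ Finset.Icc (k + 1) e, matNorm (W i) := by
    intro e he
    induction e, he using Nat.le_induction with
    | base =>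
      simp only [forward]
      rw [hlow k le_rfl]
      refine (sinLayer_sub _ _ _ _ _ _).trans ?_
      rw [add_sub_add_comm, ← Matrix.sub_mulVec]
      refine (norm_add_le _ _).trans ?_
      have h1 := mulVec_bound (W k - W' k) (forward dims W b k x)
      have h2 := mul_le_mul_of_nonneg_left hone (matNorm_nonneg' (W k - W' k))
      simp
      linarith
    | succ e he ih =>
      rw [forward, forward]
      refine (sinLayer_sub _ _ _ _ _ _).trans ?_
      rw [hW (e + 1) (by omega), hb (e + 1) (by omega), add_sub_add_right_eq_sub,
        ← Matrix.mulVec_sub]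
      refine (mulVec_bound _ _).trans ?_
      rw [Finset.prod_Icc_succ_top (by omega)]
      have h2 := mul_le_mul_of_nonneg_left ih (matNorm_nonneg' (W (e + 1)))
      refine h2.trans (le_of_eq ?_)
      ring
  rw [← Matrix.mulVec_sub]
  refine (mulVec_bound _ _).trans ?_
  refine (mul_le_mul_of_nonneg_left (key d hk2) (matNorm_nonneg' L)).trans (le_of_eq ?_)
  ring
end

section
/- Let n ≥ 1, W ∈ ℝ^n and b ∈ ℝ. Then for every y ∈ ℝ^n, the family over multi-indices k ∈ ℤ^n given by k ↦ (∏_{l=1}^n J_{k_l}(W_l)) · sin(⟨k, y⟩ + b), where ⟨k, y⟩ = ∑_{l=1}^n k_l y_l, is summable, and sin(∑_{l=1}^n W_l · sin(y_l) + b) = ∑_{k ∈ ℤ^n} (∏_{l=1}^n J_{k_l}(W_l)) · sin(⟨k, y⟩ + b). -/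
/-- Bessel function of the first kind of natural order `k`. -/
noncomputable def besselJNat (k : ℕ) (x : ℝ) : ℝ :=
  ∑' m : ℕ, (-1 : ℝ) ^ m / (Nat.factorial m * Nat.factorial (m + k)) * (x / 2) ^ (2 * m + k)

/-- Bessel function of the first kind of integer order `k`:
for `k < 0` it is defined as `(-1)^{-k} J_{-k}`. -/
noncomputable def besselJ (k : ℤ) (x : ℝ) : ℝ :=
  if 0 ≤ k then besselJNat k.toNat x
  else (-1 : ℝ) ^ (-k).toNat * besselJNat (-k).toNat x

def besselEquiv : ℤ × ℕ ≃ ℕ × ℕ where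
  toFun a := (a.2 + a.1.toNat, a.2 + (-a.1).toNat)
  invFun p := ((p.1 : ℤ) - p.2, min p.1 p.2)
  left_inv := by
    rintro ⟨k, m⟩
    simp only [Prod.mk.injEq]
    constructor <;> omega
  right_inv := by
    rintro ⟨p, q⟩
    simp only [Prod.mk.injEq]
    constructor <;> omega

theorem hasSum_pi_prod (n : ℕ) (f : Fin n → ℤ → ℂ) (a : Fin n → ℂ)
    (h : ∀ l, HasSum (f l) (a l)) :
    HasSum (fun k : Fin n → ℤ => ∏ l, f l (k l)) (∏ l, a l) := by
  induction n with
  | zero => simp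
  | succ n ih =>
    have h1 := ih (fun l => f l.succ) (fun l => a l.succ) (fun l => h _)
    have hs : Summable (fun x : ℤ × (Fin n → ℤ) => f 0 x.1 * ∏ l, f (Fin.succ l) (x.2 l)) :=
      summable_mul_of_summable_norm (f := f 0)
        (g := fun k : Fin n → ℤ => ∏ l, f (Fin.succ l) (k l)) (h 0).summable.norm h1.summable.norm
    have h2 := HasSum.mul (f := f 0) (h 0) h1 hs
    rw [Fin.prod_univ_succ, ← (Fin.consEquiv (fun _ => ℤ)).hasSum_iff]
    have he : (fun k : Fin (n + 1) → ℤ => ∏ l, f l (k l)) ∘ (Fin.consEquiv fun _ => ℤ) =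
        fun x => f 0 x.1 * ∏ l, f (Fin.succ l) (x.2 l) := by
      ext x
      obtain ⟨k, v⟩ := x
      simp [Fin.consEquiv, Fin.prod_univ_succ]
    rw [he]
    exact h2

theorem jacobi_anger (x y : ℝ) :
    HasSum (fun k : ℤ => (besselJ k x : ℂ) * Complex.exp (((k : ℝ) * y : ℝ) * Complex.I))
      (Complex.exp ((x * Real.sin y : ℝ) * Complex.I)) := by
  set z : ℂ := Complex.exp (y * Complex.I) with hz
  have hz0 : z ≠ 0 := Complex.exp_ne_zero _
  have e1 := NormedSpace.expSeries_div_hasSum_exp ((x / 2 : ℂ) * z)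
  have e2 := NormedSpace.expSeries_div_hasSum_exp (-(x / 2 : ℂ) * z⁻¹)
  have es : Summable (fun p : ℕ × ℕ => (x / 2 * z) ^ p.1 / (p.1.factorial : ℂ) *
      ((-(x / 2 : ℂ) * z⁻¹) ^ p.2 / (p.2.factorial : ℂ))) :=
    summable_mul_of_summable_norm (f := fun p : ℕ => (x / 2 * z) ^ p / (p.factorial : ℂ))
      (g := fun p : ℕ => (-(x / 2 : ℂ) * z⁻¹) ^ p / (p.factorial : ℂ))
      e1.summable.norm e2.summable.norm
  have e3 := HasSum.mul e1 e2 es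
  rw [← Complex.exp_eq_exp_ℂ, ← Complex.exp_add] at e3
  have hval : (x / 2 : ℂ) * z + -(x / 2 : ℂ) * z⁻¹ = (x * Real.sin y : ℝ) * Complex.I := by
    rw [hz, ← Complex.exp_neg]
    push_cast
    rw [Complex.sin, neg_mul (y : ℂ)]
    linear_combination (-(x:ℂ)/2 * (Complex.exp (-(y * Complex.I)) - Complex.exp (y * Complex.I))) * Complex.I_sq
  rw [hval, ← besselEquiv.hasSum_iff] at e3
  have hfib : ∀ k : ℤ, HasSum (fun m : ℕ => ((fun x_1 : ℕ × ℕ => (x / 2 * z) ^ x_1.1 / (x_1.1.factorial : ℂ) *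
      ((-(x / 2 : ℂ) * z⁻¹) ^ x_1.2 / (x_1.2.factorial : ℂ))) ∘ besselEquiv) (k, m))
      ((besselJ k x : ℂ) * Complex.exp (((k : ℝ) * y : ℝ) * Complex.I)) := by
    intro k
    have hs := (e3.summable.prod_factor k).hasSum
    refine (congrArg (HasSum _) ?_).mpr hs
    have hzk : Complex.exp (((k : ℝ) * y : ℝ) * Complex.I) = z ^ k := by
      rw [hz, ← Complex.exp_int_mul]; push_cast; ring_nf
    rw [hzk]
    unfold besselJ besselJNat
    split_ifs with hk
    · obtain ⟨j, rfl⟩ := Int.eq_ofNat_of_zero_le hk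
      rw [Complex.ofReal_tsum, ← tsum_mul_right]
      congr 1; ext m
      simp only [besselEquiv, Function.comp, Equiv.coe_fn_mk, Int.toNat_natCast,
        Int.toNat_neg_natCast, add_zero, zpow_natCast]
      push_cast
      have : z ^ (m + j) * z⁻¹ ^ m = z ^ j := by
        rw [inv_pow]; field_simp; ring
      rw [← this, mul_pow, mul_pow, neg_pow (x / 2 : ℂ)]
      generalize (x / 2 : ℂ) = t
      ring
    · obtain ⟨j, rfl⟩ : ∃ j : ℕ, k = -(j : ℤ) := ⟨(-k).toNat, by omega⟩
      rw [← tsum_mul_left, Complex.ofReal_tsum, ← tsum_mul_right]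
      congr 1; ext m
      simp only [besselEquiv, Function.comp, Equiv.coe_fn_mk, neg_neg, Int.toNat_natCast,
        Int.toNat_neg_natCast, add_zero, zpow_natCast, zpow_neg]
      push_cast
      have : z ^ m * z⁻¹ ^ (m + j) = (z ^ j)⁻¹ := by
        rw [inv_pow]; field_simp; ring
      rw [← this, mul_pow, mul_pow, neg_pow (x / 2 : ℂ)]
      generalize (x / 2 : ℂ) = t
      ring
  exact e3.prod_fiberwise hfib

theorem sin_expansion (n : ℕ) (hn : 1 ≤ n) (W : Fin n → ℝ) (b : ℝ) (y : Fin n → ℝ) :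
    Summable (fun k : Fin n → ℤ =>
      (∏ l, besselJ (k l) (W l)) * Real.sin ((∑ l, (k l : ℝ) * y l) + b)) ∧
    Real.sin ((∑ l, W l * Real.sin (y l)) + b) =
      ∑' k : Fin n → ℤ,
        (∏ l, besselJ (k l) (W l)) * Real.sin ((∑ l, (k l : ℝ) * y l) + b) := by
  have h := (hasSum_pi_prod n _ _ (fun l => jacobi_anger (W l) (y l))).mul_right
    (Complex.exp ((b : ℝ) * Complex.I))
  have h2 := Complex.hasSum_im h
  have key : HasSum (fun k : Fin n → ℤ =>
      (∏ l, besselJ (k l) (W l)) * Real.sin ((∑ l, (k l : ℝ) * y l) + b))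
      (Real.sin ((∑ l, W l * Real.sin (y l)) + b)) := by
    convert h2 using 1
    · ext k
      rw [Finset.prod_mul_distrib, ← Complex.exp_sum, mul_assoc, ← Complex.exp_add,
        ← Finset.sum_mul, ← add_mul, ← Complex.ofReal_prod, ← Complex.ofReal_sum,
        ← Complex.ofReal_add, Complex.im_ofReal_mul, Complex.exp_ofReal_mul_I_im]
    · rw [← Complex.exp_sum, ← Complex.exp_add,
        ← Finset.sum_mul, ← add_mul, ← Complex.ofReal_sum,
        ← Complex.ofReal_add, Complex.exp_ofReal_mul_I_im]
  exact ⟨key.summable, key.tsum_eq.symm⟩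
end

section
/- For every w ∈ ℝ, b ∈ ℝ and y ∈ ℝ, the family k ∈ ℤ ↦ J_k(w) · sin(k·y + b) is summable and sin(w · sin(y) + b) = ∑_{k ∈ ℤ} J_k(w) · sin(k·y + b). -/
def jaEquiv : ℤ × ℕ ≃ ℕ × ℕ where
  toFun x := (x.2 + x.1.toNat, x.2 + (-x.1).toNat)
  invFun x := ((x.1 : ℤ) - x.2, min x.1 x.2)
  left_inv := by
    rintro ⟨k, m⟩
    simp only [Prod.mk.injEq]
    omega
  right_inv := by
    rintro ⟨p, q⟩
    simp only [Prod.mk.injEq]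
    omega

noncomputable def jaTerm (w : ℝ) (x : ℕ × ℕ) : ℝ :=
  ((w / 2) ^ x.1 / (Nat.factorial x.1)) * ((-(w / 2)) ^ x.2 / (Nat.factorial x.2))

lemma jaTerm_summable (w : ℝ) : Summable (jaTerm w) := by
  have h1 := (Real.summable_pow_div_factorial (w/2)).norm
  have h2 := (Real.summable_pow_div_factorial (-(w/2))).norm
  have h3 := summable_mul_of_summable_norm h1 h2
  unfold jaTerm
  exact h3

lemma jaTerm_fiber (w : ℝ) (k : ℤ) :
    HasSum (fun m : ℕ => jaTerm w (jaEquiv (k, m))) (besselJ k w) := by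
  have hs : Summable (fun m : ℕ => jaTerm w (jaEquiv (k, m))) := by
    apply (jaTerm_summable w).comp_injective (i := fun m : ℕ => jaEquiv (k, m))
    intro a c h
    simpa using h
  convert hs.hasSum using 1
  unfold besselJ besselJNat
  split_ifs with h
  · apply tsum_congr
    intro m
    have h0 : (-k).toNat = 0 := by omega
    simp only [jaTerm, jaEquiv, Equiv.coe_fn_mk, h0, add_zero]
    rw [neg_pow (w/2) m]
    field_simp
    ring
  · rw [← tsum_mul_left]
    apply tsum_congr
    intro m
    have h0 : k.toNat = 0 := by omega
    simp only [jaTerm, jaEquiv, Equiv.coe_fn_mk, h0, add_zero]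
    rw [neg_pow (w/2)]
    field_simp
    ring

lemma ja_hasSum (w y : ℝ) :
    HasSum (fun k : ℤ => (besselJ k w : ℂ) * Complex.exp (y * Complex.I) ^ k)
      (Complex.exp ((w * Real.sin y : ℝ) * Complex.I)) := by
  set t := Complex.exp (y * Complex.I) with ht
  have ht0 : t ≠ 0 := Complex.exp_ne_zero _
  have h1 := NormedSpace.expSeries_div_hasSum_exp ((w/2 : ℂ) * t)
  have h2 := NormedSpace.expSeries_div_hasSum_exp (-(w/2 : ℂ) * t⁻¹)
  have hs := summable_mul_of_summable_norm
    (NormedSpace.norm_expSeries_div_summable ((w/2 : ℂ) * t))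
    (NormedSpace.norm_expSeries_div_summable (-(w/2 : ℂ) * t⁻¹))
  have h3 := h1.mul h2 hs
  rw [← Complex.exp_eq_exp_ℂ, ← Complex.exp_add] at h3
  have h4 : (w/2 : ℂ) * t + -(w/2 : ℂ) * t⁻¹ = (w * Real.sin y : ℝ) * Complex.I := by
    rw [ht, ← Complex.exp_neg]
    push_cast
    rw [Complex.sin, neg_mul, neg_mul]
    linear_combination (-(w/2 : ℂ)) * (Complex.exp (-(y * Complex.I)) -
      Complex.exp (y * Complex.I)) * Complex.I_sq
  rw [h4, ← jaEquiv.hasSum_iff] at h3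
  refine h3.prod_fiberwise fun k => ?_
  have h5 := (Complex.hasSum_ofReal.2 (jaTerm_fiber w k)).mul_right (t ^ k)
  convert h5 using 2 with m
  have hk : t ^ k = t ^ (m + k.toNat) * (t⁻¹) ^ (m + (-k).toNat) := by
    rw [inv_pow, ← zpow_natCast, ← zpow_natCast, ← zpow_neg, ← zpow_add₀ ht0]
    congr 1
    push_cast
    omega
  rw [hk]
  simp only [jaTerm, jaEquiv, Equiv.coe_fn_mk, Function.comp]
  push_cast
  rw [mul_pow, mul_pow]
  ring

theorem jacobi_anger_sin_phase (w b y : ℝ) :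
    Summable (fun k : ℤ => besselJ k w * Real.sin (k * y + b)) ∧
    Real.sin (w * Real.sin y + b) = ∑' k : ℤ, besselJ k w * Real.sin (k * y + b) := by
  have h := Complex.hasSum_im ((ja_hasSum w y).mul_right (Complex.exp (b * Complex.I)))
  have key : HasSum (fun k : ℤ => besselJ k w * Real.sin (k * y + b))
      (Real.sin (w * Real.sin y + b)) := by
    convert h using 1
    · ext k
      rw [mul_assoc, ← Complex.exp_int_mul, ← Complex.exp_add, Complex.im_ofReal_mul,
        ← Complex.exp_ofReal_mul_I_im]
      congr 3
      push_cast
      ring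
    · rw [← Complex.exp_add, ← Complex.exp_ofReal_mul_I_im]
      congr 2
      push_cast
      ring
  exact ⟨key.summable, key.tsum_eq.symm⟩
end

section
/- (Neuron pruning stability.) Let d ≥ 1 and let f = L ∘ S^d ∘ ⋯ ∘ S^0 be a sinusoidal INR of depth d with weight matrices W^0, …, W^d, biases b^0, …, b^d, and output matrix L. Fix k with 1 ≤ k ≤ d and a column index j, and let f̃ be the network obtained from f by replacing W^k with the matrix W̃^k whose j-th column is zero and whose other columns agree with those of W^k (biases and all other layers unchanged). Then for every x ∈ ℝ^{n_0}, ‖f(x) − f̃(x)‖∞ ≤ (∑_i |W^k_{ij}|) · ‖L‖∞ · ∏_{i=k+1}^{d} ‖W^i‖∞, where ∑_i |W^k_{ij}| is the ℓ1 norm of the j-th column of W^k. -/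
theorem aux_mulVec {m n : ℕ} (A : Matrix (Fin m) (Fin n) ℝ) (v : Fin n → ℝ) :
    ‖A.mulVec v‖ ≤ matNorm A * ‖v‖ := by
  have hbd : BddAbove (Set.range fun i => ∑ j, |A i j|) := Set.finite_range _ |>.bddAbove
  have h0 : 0 ≤ matNorm A :=
    Real.iSup_nonneg fun i => Finset.sum_nonneg fun j _ => abs_nonneg _
  refine (pi_norm_le_iff_of_nonneg (mul_nonneg h0 (norm_nonneg _))).2 fun i => ?_
  calc ‖A.mulVec v i‖ ≤ ∑ j, ‖A i j * v j‖ := by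
        simp only [Matrix.mulVec, dotProduct]
        exact norm_sum_le _ _
    _ ≤ ∑ j, |A i j| * ‖v‖ := by
        refine Finset.sum_le_sum fun j _ => ?_
        rw [norm_mul, Real.norm_eq_abs]
        exact mul_le_mul_of_nonneg_left (norm_le_pi_norm v j) (abs_nonneg _)
    _ = (∑ j, |A i j|) * ‖v‖ := by rw [Finset.sum_mul]
    _ ≤ matNorm A * ‖v‖ :=
        mul_le_mul_of_nonneg_right (le_ciSup hbd i) (norm_nonneg _)

theorem aux_sin (a b : ℝ) : |Real.sin a - Real.sin b| ≤ |a - b| := by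
  have h := Real.lipschitzWith_sin.dist_le_mul a b
  simpa [Real.dist_eq] using h

theorem aux_layer {m n : ℕ} (A : Matrix (Fin m) (Fin n) ℝ) (b : Fin m → ℝ) (v w : Fin n → ℝ) :
    ‖sinLayer A b v - sinLayer A b w‖ ≤ matNorm A * ‖v - w‖ := by
  refine le_trans ?_ (aux_mulVec A (v - w))
  refine (pi_norm_le_iff_of_nonneg (norm_nonneg _)).2 fun i => ?_
  refine le_trans ?_ (norm_le_pi_norm _ i)
  rw [Matrix.mulVec_sub]
  simp only [sinLayer, Pi.sub_apply, Real.norm_eq_abs]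
  refine (aux_sin _ _).trans (le_of_eq ?_)
  congr 1
  ring

theorem neuron_pruning_stability
    (d : ℕ) (hd : 1 ≤ d) (dims : ℕ → ℕ) (nout : ℕ)
    (W W' : ∀ i, Matrix (Fin (dims (i + 1))) (Fin (dims i)) ℝ)
    (b : ∀ i, Fin (dims (i + 1)) → ℝ)
    (L : Matrix (Fin nout) (Fin (dims (d + 1))) ℝ)
    (k : ℕ) (hk1 : 1 ≤ k) (hk2 : k ≤ d) (j : Fin (dims k))
    (hW : ∀ i, i ≠ k → W' i = W i)
    (hWk : ∀ i j', W' k i j' = if j' = j then 0 else W k i j')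
    (x : Fin (dims 0) → ℝ) :
    ‖L.mulVec (forward dims W b (d + 1) x) - L.mulVec (forward dims W' b (d + 1) x)‖ ≤
      (∑ i, |W k i j|) * matNorm L * ∏ i ∈ Finset.Icc (k + 1) d, matNorm (W i) := by
  have hnn : ∀ {m n : ℕ} (A : Matrix (Fin m) (Fin n) ℝ), 0 ≤ matNorm A := fun A =>
    Real.iSup_nonneg fun i => Finset.sum_nonneg fun j _ => abs_nonneg _
  have hpre : ∀ m, m ≤ k → forward dims W' b m x = forward dims W b m x := by
    intro m
    induction m with
    | zero => intro _; rfl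
    | succ m ih =>
      intro hm
      simp only [forward]
      rw [ih (by omega), hW m (by omega)]
  have hone : ∀ i, |forward dims W b k x i| ≤ 1 := by
    cases k with
    | zero => omega
    | succ k => intro i; exact Real.abs_sin_le_one _
  have hC : 0 ≤ ∑ i, |W k i j| := Finset.sum_nonneg fun i _ => abs_nonneg _
  have key : ∀ t, ‖forward dims W b (k + t + 1) x - forward dims W' b (k + t + 1) x‖ ≤
      (∑ i, |W k i j|) * ∏ i ∈ Finset.Icc (k + 1) (k + t), matNorm (W i) := by
    intro t
    induction t with
    | zero =>
      simp only [add_zero, Finset.Icc_eq_empty_of_lt (Nat.lt_succ_self k), Finset.prod_empty,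
        mul_one]
      refine (pi_norm_le_iff_of_nonneg hC).2 fun i => ?_
      simp only [forward]
      rw [hpre k le_rfl]
      simp only [sinLayer, Pi.sub_apply, Real.norm_eq_abs]
      refine (aux_sin _ _).trans ?_
      have : (W k).mulVec (forward dims W b k x) i + b k i -
          ((W' k).mulVec (forward dims W b k x) i + b k i) = W k i j * forward dims W b k x j := by
        rw [add_sub_add_right_eq_sub]
        simp only [Matrix.mulVec, dotProduct]
        rw [← Finset.sum_sub_distrib, Finset.sum_eq_single j]
        · simp [hWk]
        · intro c _ hc
          simp [hWk, hc]
        · simp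
      rw [this, abs_mul]
      calc |W k i j| * |forward dims W b k x j| ≤ |W k i j| * 1 :=
            mul_le_mul_of_nonneg_left (hone j) (abs_nonneg _)
        _ = |W k i j| := mul_one _
        _ ≤ _ := Finset.single_le_sum (f := fun i => |W k i j|) (fun i _ => abs_nonneg _)
            (Finset.mem_univ i)
    | succ t ih =>
      have e : ‖forward dims W b (k + (t + 1) + 1) x - forward dims W' b (k + (t + 1) + 1) x‖ ≤
          matNorm (W (k + t + 1)) *
            ‖forward dims W b (k + t + 1) x - forward dims W' b (k + t + 1) x‖ := by
        change ‖sinLayer (W (k + t + 1)) (b (k + t + 1)) (forward dims W b (k + t + 1) x) -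
          sinLayer (W' (k + t + 1)) (b (k + t + 1)) (forward dims W' b (k + t + 1) x)‖ ≤ _
        rw [hW (k + t + 1) (by omega)]
        exact aux_layer _ _ _ _
      refine e.trans ((mul_le_mul_of_nonneg_left ih (hnn _)).trans (le_of_eq ?_))
      rw [← add_assoc k t 1, Finset.prod_Icc_succ_top (by omega)]
      ring
  obtain ⟨t, rfl⟩ := Nat.exists_eq_add_of_le hk2
  rw [← Matrix.mulVec_sub]
  refine (aux_mulVec _ _).trans ((mul_le_mul_of_nonneg_left (key t) (hnn _)).trans (le_of_eq ?_))
  ring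
end
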